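/- arXiv:0906.1856 — 5 statements merged into one kernel-verified Lean document; each statement's English description precedes it below -/
import Mathlib

section
/- The family (Ψ_{s,t})_{0≤s<t<∞} has the semigroup property under functional iteration: for all 0 ≤ t₁ < t₂ < t₃ < ∞ and all λ ≥ 0, Ψ_{t₁,t₂}(Ψ_{t₂,t₃}(λ)) = Ψ_{t₁,t₃}(λ). -/
open MeasureTheory Filter Set

/-- `C(s,t) = ∫_s^t (σ²(v)/2)·exp(∫_0^v β(u)du) dv` -/
noncomputable def Cf (σ β : ℝ → ℝ) (s t : ℝ) : ℝ :=
  ∫ v in s..t, σ v ^ 2 / 2 * Real.exp (∫ u in (0:ℝ)..v, β u)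

/-- `B(s,t) = exp(−∫_s^t β(v)dv)` -/
noncomputable def Bf (β : ℝ → ℝ) (s t : ℝ) : ℝ :=
  Real.exp (-∫ v in s..t, β v)

/-- `p(s,t) = 1/(B(0,t)·C(s,t))` -/
noncomputable def pf (σ β : ℝ → ℝ) (s t : ℝ) : ℝ :=
  1 / (Bf β 0 t * Cf σ β s t)

/-- `γ(s,t) = 1/(B(0,s)·C(s,t))` -/
noncomputable def gf (σ β : ℝ → ℝ) (s t : ℝ) : ℝ :=
  1 / (Bf β 0 s * Cf σ β s t)

/-- `Ψ_{s,t}(λ) = γ(s,t)·λ/(p(s,t)+λ)` -/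
noncomputable def Psi (σ β : ℝ → ℝ) (s t l : ℝ) : ℝ :=
  gf σ β s t * l / (pf σ β s t + l)

lemma continuousOn_Cf_integrand {σ β : ℝ → ℝ} (hσc : ContinuousOn σ (Set.Ici 0))
    (hβc : ContinuousOn β (Set.Ici 0)) {T : ℝ} (hT : 0 ≤ T) :
    ContinuousOn (fun v => σ v ^ 2 / 2 * Real.exp (∫ u in (0:ℝ)..v, β u)) (Set.Icc 0 T) := by
  have hβT : ContinuousOn β (Set.uIcc 0 T) := by
    rw [Set.uIcc_of_le hT]
    exact hβc.mono Set.Icc_subset_Ici_self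
  have hprim : ContinuousOn (fun v => ∫ u in (0:ℝ)..v, β u) (Set.Icc 0 T) := by
    have h := intervalIntegral.continuousOn_primitive_interval
      (hβT.integrableOn_compact (μ := volume) isCompact_uIcc)
    rwa [Set.uIcc_of_le hT] at h
  have hσT : ContinuousOn σ (Set.Icc 0 T) := hσc.mono Set.Icc_subset_Ici_self
  exact ((hσT.pow 2).div_const 2).mul hprim.rexp

lemma intervalIntegrable_Cf_integrand {σ β : ℝ → ℝ} (hσc : ContinuousOn σ (Set.Ici 0))
    (hβc : ContinuousOn β (Set.Ici 0)) {s t : ℝ} (hs : 0 ≤ s) (hst : s ≤ t) :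
    IntervalIntegrable (fun v => σ v ^ 2 / 2 * Real.exp (∫ u in (0:ℝ)..v, β u)) volume s t := by
  apply ContinuousOn.intervalIntegrable
  rw [Set.uIcc_of_le hst]
  exact (continuousOn_Cf_integrand hσc hβc (hs.trans hst)).mono (Set.Icc_subset_Icc_left hs)

lemma Cf_pos {σ β : ℝ → ℝ} (hσc : ContinuousOn σ (Set.Ici 0))
    (hβc : ContinuousOn β (Set.Ici 0)) (hσpos : ∀ x ∈ Set.Ici (0:ℝ), 0 < σ x)
    {s t : ℝ} (hs : 0 ≤ s) (hst : s < t) : 0 < Cf σ β s t := by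
  refine intervalIntegral.intervalIntegral_pos_of_pos_on
    (intervalIntegrable_Cf_integrand hσc hβc hs hst.le) (fun v hv => ?_) hst
  have := hσpos v (hs.trans hv.1.le)
  positivity

lemma Cf_add {σ β : ℝ → ℝ} (hσc : ContinuousOn σ (Set.Ici 0))
    (hβc : ContinuousOn β (Set.Ici 0)) {r s t : ℝ} (hr : 0 ≤ r) (hrs : r ≤ s) (hst : s ≤ t) :
    Cf σ β r s + Cf σ β s t = Cf σ β r t :=
  intervalIntegral.integral_add_adjacent_intervals
    (intervalIntegrable_Cf_integrand hσc hβc hr hrs)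
    (intervalIntegrable_Cf_integrand hσc hβc (hr.trans hrs) hst)

lemma Psi_eq {σ β : ℝ → ℝ} {s t l : ℝ} (hC : 0 < Cf σ β s t) (hl : 0 ≤ l) :
    Psi σ β s t l = Bf β 0 t * l / (Bf β 0 s * (1 + Cf σ β s t * (Bf β 0 t * l))) := by
  have hs : 0 < Bf β 0 s := Real.exp_pos _
  have ht : 0 < Bf β 0 t := Real.exp_pos _
  unfold Psi gf pf
  have : 0 < 1 / (Bf β 0 t * Cf σ β s t) + l := by positivity
  field_simp

/-- Semigroup property under functional iteration:
`Ψ_{t₁,t₂} ∘ Ψ_{t₂,t₃} = Ψ_{t₁,t₃}` on `[0,∞)` for `0 ≤ t₁ < t₂ < t₃ < ∞`. -/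
theorem stmt_6 (σ β : ℝ → ℝ)
    (hσc : ContinuousOn σ (Set.Ici 0)) (hβc : ContinuousOn β (Set.Ici 0))
    (hσpos : ∀ x ∈ Set.Ici (0:ℝ), 0 < σ x) (hβnn : ∀ x ∈ Set.Ici (0:ℝ), 0 ≤ β x)
    (t₁ t₂ t₃ : ℝ) (h₁ : 0 ≤ t₁) (h₁₂ : t₁ < t₂) (h₂₃ : t₂ < t₃)
    (l : ℝ) (hl : 0 ≤ l) :
    Psi σ β t₁ t₂ (Psi σ β t₂ t₃ l) = Psi σ β t₁ t₃ l := by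
  have hC₁₂ := Cf_pos hσc hβc hσpos h₁ h₁₂
  have hC₂₃ := Cf_pos hσc hβc hσpos (h₁.trans h₁₂.le) h₂₃
  have hC₁₃ := Cf_pos hσc hβc hσpos h₁ (h₁₂.trans h₂₃)
  have hadd := Cf_add hσc hβc h₁ h₁₂.le h₂₃.le
  have hb₁ : 0 < Bf β 0 t₁ := Real.exp_pos _
  have hb₂ : 0 < Bf β 0 t₂ := Real.exp_pos _
  have hb₃ : 0 < Bf β 0 t₃ := Real.exp_pos _
  have hΨ := Psi_eq hC₂₃ hl
  have hΨ_nonneg : 0 ≤ Psi σ β t₂ t₃ l := by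
    rw [hΨ]
    positivity
  rw [Psi_eq hC₁₂ hΨ_nonneg, Psi_eq hC₁₃ hl, hΨ, ← hadd]
  field_simp
  ring
end

section
/- Let θ ≥ 0 and p > 0, and define the measure μ := e^{−θ}·δ₀ + Σ_{m=1}^∞ (e^{−θ} θ^m / m!) · Γ(m,p) on [0,∞), i.e. the Poisson(θ)-mixture which puts the Poisson weight e^{−θ}θ^m/m! on the Gamma law Γ(m,p) for m ≥ 1 and weight e^{−θ} on the Dirac measure at 0. Then μ is a probability measure on [0,∞) and its Laplace transform is given by ∫_{[0,∞)} e^{−λx} μ(dx) = exp(−θ·λ/(p+λ)) for all λ ≥ 0. -/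
open MeasureTheory Filter Set ProbabilityTheory

/-- The Poisson(θ)-mixture of Gamma laws: weight `e^{−θ}` on the Dirac measure at `0` and
weight `e^{−θ}θ^m/m!` on the Gamma law `Γ(m,p)` for `m ≥ 1`. -/
noncomputable def poissonGammaMix (θ p : ℝ) : Measure ℝ :=
  ENNReal.ofReal (Real.exp (-θ)) • Measure.dirac 0 +
  Measure.sum (fun m : ℕ =>
    ENNReal.ofReal (Real.exp (-θ) * θ ^ (m + 1) / (Nat.factorial (m + 1))) •
      gammaMeasure ((m : ℝ) + 1) p)

/-- The Laplace transform of the Gamma law, as a lower Lebesgue integral. -/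
lemma lintegral_exp_neg_mul_gammaMeasure {a p l : ℝ} (ha : 0 < a) (hp : 0 < p) (hl : 0 ≤ l) :
    ∫⁻ x, ENNReal.ofReal (Real.exp (-(l * x))) ∂(gammaMeasure a p) =
      ENNReal.ofReal ((p / (p + l)) ^ a) := by
  have hpl : 0 < p + l := by positivity
  have hmeas (r : ℝ) : Measurable (gammaPDF a r) := (measurable_gammaPDFReal a r).ennreal_ofReal
  have htilt (x : ℝ) : gammaPDF a p x * ENNReal.ofReal (Real.exp (-(l * x))) =
      ENNReal.ofReal ((p / (p + l)) ^ a) * gammaPDF a (p + l) x := by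
    rcases lt_or_ge x 0 with hx | hx
    · simp [gammaPDF_of_neg hx]
    · rw [gammaPDF_of_nonneg hx, gammaPDF_of_nonneg hx, ← ENNReal.ofReal_mul' (by positivity),
        ← ENNReal.ofReal_mul (by positivity), Real.div_rpow hp.le hpl.le]
      congr 1
      have hexp : Real.exp (-((p + l) * x)) = Real.exp (-(p * x)) * Real.exp (-(l * x)) := by
        rw [← Real.exp_add]; ring_nf
      have hpow : (p + l) ^ a ≠ 0 := by positivity
      have hGamma : Real.Gamma a ≠ 0 := (Real.Gamma_pos_of_pos ha).ne'
      rw [hexp]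
      field_simp
  rw [gammaMeasure, lintegral_withDensity_eq_lintegral_mul _ (hmeas p) (by fun_prop)]
  simp only [Pi.mul_apply, htilt]
  rw [lintegral_const_mul _ (hmeas _), lintegral_gammaPDF_eq_one ha hpl, mul_one]

/-- The Laplace transform of `poissonGammaMix`, as a lower Lebesgue integral. -/
lemma lintegral_exp_neg_mul_poissonGammaMix {θ p l : ℝ} (hθ : 0 ≤ θ) (hp : 0 < p) (hl : 0 ≤ l) :
    ∫⁻ x, ENNReal.ofReal (Real.exp (-(l * x))) ∂(poissonGammaMix θ p) =
      ENNReal.ofReal (Real.exp (-(θ * l / (p + l)))) := by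
  have hpl : 0 < p + l := by positivity
  set q : ℝ := p / (p + l) with hq
  have hq0 : 0 ≤ q := by positivity
  have hterm (m : ℕ) : ENNReal.ofReal (Real.exp (-θ) * θ ^ (m + 1) / (Nat.factorial (m + 1))) *
      ENNReal.ofReal (q ^ ((m : ℝ) + 1)) =
      ENNReal.ofReal (Real.exp (-θ) * ((θ * q) ^ (m + 1) / (Nat.factorial (m + 1)))) := by
    rw [← ENNReal.ofReal_mul (by positivity)]
    congr 1
    rw [← Nat.cast_add_one, Real.rpow_natCast, mul_pow]
    ring
  have hsum : HasSum (fun m : ℕ => Real.exp (-θ) * ((θ * q) ^ m / (Nat.factorial m)))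
      (Real.exp (-(θ * l / (p + l)))) := by
    have h := (NormedSpace.expSeries_div_hasSum_exp (θ * q)).mul_left (Real.exp (-θ))
    have hexp : -(θ * l / (p + l)) = -θ + θ * q := by
      rw [hq]
      field_simp
      ring
    rwa [← Real.exp_eq_exp_ℝ, ← Real.exp_add, ← hexp] at h
  rw [poissonGammaMix, lintegral_add_measure, lintegral_smul_measure, lintegral_sum_measure,
    lintegral_dirac]
  simp only [lintegral_smul_measure, smul_eq_mul]
  have hgamma (m : ℕ) := lintegral_exp_neg_mul_gammaMeasure (a := (m : ℝ) + 1) (by positivity) hp hl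
  simp only [hgamma, ← hq, hterm]
  rw [← hsum.tsum_eq, ENNReal.ofReal_tsum_of_nonneg (fun m => by positivity) hsum.summable]
  conv_rhs => rw [tsum_eq_zero_add' ENNReal.summable]
  simp

/-- The Poisson mixture of Gamma laws is a probability measure with Laplace transform
`λ ↦ exp(−θ·λ/(p+λ))`. -/
theorem stmt_8 (θ p : ℝ) (hθ : 0 ≤ θ) (hp : 0 < p) :
    IsProbabilityMeasure (poissonGammaMix θ p) ∧
    ∀ l : ℝ, 0 ≤ l →
      (∫ x, Real.exp (-(l * x)) ∂(poissonGammaMix θ p)) = Real.exp (-(θ * l / (p + l))) := by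
  refine ⟨⟨?_⟩, fun l hl => ?_⟩
  · simpa using lintegral_exp_neg_mul_poissonGammaMix hθ hp le_rfl
  · rw [integral_eq_lintegral_of_nonneg_ae (.of_forall fun x => (Real.exp_pos _).le)
      (by fun_prop), lintegral_exp_neg_mul_poissonGammaMix hθ hp hl,
      ENNReal.toReal_ofReal (Real.exp_pos _).le]
end

section
/- For all 0 ≤ s < t < ∞ and all λ ≥ 0, exp( − ∫_s^t (σ²(v)/2) Ψ_{v,t}(λ) dv ) = (1 + λ/p(s,t))^{−1}. -/
open MeasureTheory Filter Set

/-- A continuous curve agrees on `[0, ∞)` with its extension by a constant to the left. -/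
theorem continuous_comp_max_zero {f : ℝ → ℝ} (hf : ContinuousOn f (Set.Ici 0)) :
    Continuous fun x => f (max 0 x) :=
  hf.comp_continuous (by fun_prop) fun x => le_max_left 0 x

/-- Logarithmic integration of `c·g / (1 + c·∫_v^t g)` for a continuous nonnegative `g`. -/
theorem exp_neg_integral_mul_div_one_add_mul_integral {g : ℝ → ℝ} (hg : Continuous g)
    (hg0 : ∀ x, 0 ≤ g x) {c : ℝ} (hc : 0 ≤ c) {s t : ℝ} (hst : s ≤ t) :
    Real.exp (-∫ v in s..t, c * g v / (1 + c * ∫ x in v..t, g x)) =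
      (1 + c * ∫ x in s..t, g x)⁻¹ := by
  have hpos : ∀ v ≤ t, 0 < 1 + c * ∫ x in v..t, g x := fun v hv => by
    have := intervalIntegral.integral_nonneg (μ := volume) hv fun x _ => hg0 x
    positivity
  have hderiv : ∀ v, HasDerivAt (fun v => 1 + c * ∫ x in v..t, g x) (c * -g v) v := fun v =>
    ((intervalIntegral.integral_hasDerivAt_left (hg.intervalIntegrable v t)
      hg.aestronglyMeasurable.stronglyMeasurableAtFilter hg.continuousAt).const_mul c).const_add 1
  have hcont : Continuous fun v => 1 + c * ∫ x in v..t, g x :=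
    continuous_iff_continuousAt.2 fun v => (hderiv v).continuousAt
  have hlog : ∫ v in s..t, c * g v / (1 + c * ∫ x in v..t, g x) =
      Real.log (1 + c * ∫ x in s..t, g x) := by
    rw [intervalIntegral.integral_eq_sub_of_hasDerivAt
      (f := fun v => -Real.log (1 + c * ∫ x in v..t, g x))]
    · simp
    · intro v hv
      rw [uIcc_of_le hst] at hv
      exact ((hderiv v).log (hpos v hv.2).ne').neg.congr_deriv (by rw [mul_neg, neg_div, neg_neg])
    · refine ContinuousOn.intervalIntegrable ?_
      rw [uIcc_of_le hst]
      exact (hg.const_mul c).continuousOn.div hcont.continuousOn fun v hv => (hpos v hv.2).ne'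
  rw [hlog, Real.exp_neg, Real.exp_log (hpos s hst)]

/-- `exp(−∫_s^t (σ²(v)/2)·Ψ_{v,t}(λ) dv) = (1 + λ/p(s,t))⁻¹`. -/
theorem stmt_13 (σ β : ℝ → ℝ)
    (hσc : ContinuousOn σ (Set.Ici 0)) (hβc : ContinuousOn β (Set.Ici 0))
    (hσpos : ∀ x ∈ Set.Ici (0:ℝ), 0 < σ x) (hβnn : ∀ x ∈ Set.Ici (0:ℝ), 0 ≤ β x)
    (s t : ℝ) (hs : 0 ≤ s) (hst : s < t) (l : ℝ) (hl : 0 ≤ l) :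
    Real.exp (-∫ v in s..t, σ v ^ 2 / 2 * Psi σ β v t l) =
      (1 + l / pf σ β s t)⁻¹ := by
  set g : ℝ → ℝ := fun v =>
    σ (max 0 v) ^ 2 / 2 * Real.exp (∫ u in (0:ℝ)..v, β (max 0 u)) with hgdef
  have hg : Continuous g := by
    have hσ := continuous_comp_max_zero hσc
    have hI := intervalIntegral.continuous_primitive
      (fun a b => (continuous_comp_max_zero hβc).intervalIntegrable (μ := volume) a b) 0
    exact ((hσ.pow 2).div_const 2).mul hI.rexp
  have hgpos : ∀ x, 0 < g x := fun x => by
    have := hσpos _ (le_max_left 0 x)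
    positivity
  have hgeq : ∀ v, 0 ≤ v → σ v ^ 2 / 2 * Real.exp (∫ u in (0:ℝ)..v, β u) = g v := by
    intro v hv
    have : ∫ u in (0:ℝ)..v, β (max 0 u) = ∫ u in (0:ℝ)..v, β u := by
      refine intervalIntegral.integral_congr fun u hu => ?_
      rw [uIcc_of_le hv] at hu
      simp only [max_eq_right hu.1]
    simp only [hgdef, this, max_eq_right hv]
  have hC : ∀ v, 0 ≤ v → v ≤ t → Cf σ β v t = ∫ x in v..t, g x := by
    intro v hv hvt
    refine intervalIntegral.integral_congr fun x hx => ?_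
    rw [uIcc_of_le hvt] at hx
    exact hgeq x (hv.trans hx.1)
  have hB : 0 < Bf β 0 t := Real.exp_pos _
  have key : ∫ v in s..t, σ v ^ 2 / 2 * Psi σ β v t l =
      ∫ v in s..t, l * Bf β 0 t * g v / (1 + l * Bf β 0 t * ∫ x in v..t, g x) := by
    refine intervalIntegral.integral_congr_ae ?_
    filter_upwards [Measure.ae_ne volume t] with v hvt hv
    rw [uIoc_of_le hst.le] at hv
    have hv0 : 0 ≤ v := hs.trans hv.1.le
    have hCpos : 0 < ∫ x in v..t, g x :=
      intervalIntegral.intervalIntegral_pos_of_pos (hg.intervalIntegrable v t) hgpos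
        (lt_of_le_of_ne hv.2 hvt)
    rw [← hgeq v hv0, Psi, gf, pf, hC v hv0 hv.2, show Bf β 0 v = _ from Real.exp_neg _]
    have hE := Real.exp_pos (∫ u in (0:ℝ)..v, β u)
    field_simp
  rw [key, exp_neg_integral_mul_div_one_add_mul_integral hg (fun x => (hgpos x).le)
    (mul_nonneg hl hB.le) hst.le, pf, hC s hs hst.le, div_div_eq_mul_div, div_one, mul_assoc]
end

section
/- Let α > 0 be a constant. For all 0 ≤ s < t < ∞ and all λ ≥ 0, exp( − ∫_s^t (σ²(v)/2)·α·Ψ_{v,t}(λ) dv ) = (1 + λ/p(s,t))^{−α}, and the right-hand side is the Laplace transform of the Gamma law Γ(α, p(s,t)): (1 + λ/p(s,t))^{−α} = ∫_{(0,∞)} e^{−λx} Γ(α, p(s,t))(dx). -/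
open MeasureTheory Filter Set

/-- The Laplace transform of the Gamma law, at every `l > -r`. -/
theorem integral_exp_neg_mul_gammaMeasure {a r l : ℝ} (ha : 0 < a) (hr : 0 < r)
    (hrl : 0 < r + l) :
    ∫ x, Real.exp (-(l * x)) ∂(ProbabilityTheory.gammaMeasure a r) = (1 + l / r) ^ (-a) := by
  have hmeas : Measurable (ProbabilityTheory.gammaPDF a r) :=
    (ProbabilityTheory.measurable_gammaPDFReal a r).ennreal_ofReal
  have hpdf (x : ℝ) : (ProbabilityTheory.gammaPDF a r x).toReal • Real.exp (-(l * x)) =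
      (Ici (0 : ℝ)).indicator
        (fun x => r ^ a / Real.Gamma a * (x ^ (a - 1) * Real.exp (-((r + l) * x)))) x := by
    rw [ProbabilityTheory.gammaPDF,
      ENNReal.toReal_ofReal (ProbabilityTheory.gammaPDFReal_nonneg ha hr x),
      ProbabilityTheory.gammaPDFReal, smul_eq_mul]
    by_cases hx : 0 ≤ x
    · rw [if_pos hx, indicator_of_mem (mem_Ici.2 hx),
        show -((r + l) * x) = -(r * x) + -(l * x) by ring, Real.exp_add]
      ring
    · rw [if_neg hx, indicator_of_notMem (by simpa using hx), zero_mul]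
  rw [ProbabilityTheory.gammaMeasure, integral_withDensity_eq_integral_toReal_smul hmeas
    (ae_of_all _ fun _ => ENNReal.ofReal_lt_top)]
  simp_rw [hpdf]
  rw [integral_indicator measurableSet_Ici, integral_Ici_eq_integral_Ioi, integral_const_mul,
    Real.integral_rpow_mul_exp_neg_mul_Ioi ha hrl,
    show 1 + l / r = (r + l) / r by field_simp,
    Real.rpow_neg (by positivity), Real.div_rpow hrl.le hr.le, Real.div_rpow zero_le_one hrl.le,
    Real.one_rpow]
  have := (Real.Gamma_pos_of_pos ha).ne'
  field_simp

/-- The logarithmic derivative of `1 + c ∫_v^t g` integrates to its logarithm. -/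
theorem integral_mul_div_one_add_mul_integral {g : ℝ → ℝ} {s t c : ℝ} (hst : s ≤ t)
    (hg : ContinuousOn g (Icc s t)) (hg0 : ∀ v ∈ Icc s t, 0 ≤ g v) (hc : 0 ≤ c) :
    ∫ v in s..t, g v * c / (1 + c * ∫ w in v..t, g w) =
      Real.log (1 + c * ∫ w in s..t, g w) := by
  have hD0 : ∀ v ∈ Icc s t, 0 < 1 + c * ∫ w in v..t, g w := fun v hv => by
    have : 0 ≤ ∫ w in v..t, g w :=
      intervalIntegral.integral_nonneg hv.2 fun w hw => hg0 w ⟨hv.1.trans hw.1, hw.2⟩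
    positivity
  have hDc : ContinuousOn (fun v => 1 + c * ∫ w in v..t, g w) (Icc s t) := by
    have h := intervalIntegral.continuousOn_primitive_interval_left (a := s) (b := t)
      (f := g) (μ := volume) (by rw [uIcc_of_le hst]; exact hg.integrableOn_Icc)
    rw [uIcc_of_le hst] at h
    exact continuousOn_const.add (continuousOn_const.mul h)
  have hderiv : ∀ v ∈ Ioo s t, HasDerivAt (fun v => -Real.log (1 + c * ∫ w in v..t, g w))
      (g v * c / (1 + c * ∫ w in v..t, g w)) v := fun v hv => by
    have hint : IntervalIntegrable g volume v t := by
      refine ContinuousOn.intervalIntegrable_of_Icc hv.2.le (hg.mono ?_)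
      exact Icc_subset_Icc_left hv.1.le
    have hD := intervalIntegral.integral_hasDerivAt_left hint
      ((hg.mono Ioo_subset_Icc_self).stronglyMeasurableAtFilter isOpen_Ioo v hv)
      (hg.continuousAt (Icc_mem_nhds hv.1 hv.2))
    refine (((hD.const_mul c).const_add 1).log (hD0 v (Ioo_subset_Icc_self hv)).ne').neg.congr_deriv
      ?_
    ring
  rw [intervalIntegral.integral_eq_sub_of_hasDerivAt_of_le hst
    (hDc.log fun v hv => (hD0 v hv).ne').neg hderiv
    (((hg.mul continuousOn_const).div hDc
      fun v hv => (hD0 v hv).ne').intervalIntegrable_of_Icc hst)]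
  simp

open ProbabilityTheory in
/-- For constant `α > 0`: `exp(−∫_s^t (σ²(v)/2)·α·Ψ_{v,t}(λ) dv) = (1+λ/p(s,t))^{−α}`,
which is the Laplace transform of the Gamma law `Γ(α,p(s,t))`. -/
theorem stmt_14 (σ β : ℝ → ℝ)
    (hσc : ContinuousOn σ (Set.Ici 0)) (hβc : ContinuousOn β (Set.Ici 0))
    (hσpos : ∀ x ∈ Set.Ici (0:ℝ), 0 < σ x) (hβnn : ∀ x ∈ Set.Ici (0:ℝ), 0 ≤ β x)
    (α : ℝ) (hα : 0 < α)
    (s t : ℝ) (hs : 0 ≤ s) (hst : s < t) (l : ℝ) (hl : 0 ≤ l) :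
    Real.exp (-∫ v in s..t, σ v ^ 2 / 2 * α * Psi σ β v t l) =
      (1 + l / pf σ β s t) ^ (-α) ∧
    (1 + l / pf σ β s t) ^ (-α) =
      ∫ x, Real.exp (-(l * x)) ∂(gammaMeasure α (pf σ β s t)) := by
  have hE : ContinuousOn (fun v => Real.exp (∫ u in (0 : ℝ)..v, β u)) (Icc 0 t) := by
    have h := intervalIntegral.continuousOn_primitive_interval (a := 0) (b := t)
      (f := β) (μ := volume) (by
        rw [uIcc_of_le (hs.trans hst.le)]
        exact (hβc.mono Icc_subset_Ici_self).integrableOn_Icc)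
    rw [uIcc_of_le (hs.trans hst.le)] at h
    exact h.rexp
  have hg : ContinuousOn (fun v => σ v ^ 2 / 2 * Real.exp (∫ u in (0 : ℝ)..v, β u))
      (Icc s t) :=
    ((((hσc.mono Icc_subset_Ici_self).pow 2).div_const 2).mul hE).mono (Icc_subset_Icc_left hs)
  have hgpos : ∀ v ∈ Icc s t, 0 < σ v ^ 2 / 2 * Real.exp (∫ u in (0 : ℝ)..v, β u) :=
    fun v hv => by
      have := hσpos v (hs.trans hv.1)
      positivity
  have hC : ∀ v ∈ Ico s t, 0 < Cf σ β v t := fun v hv =>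
    intervalIntegral.intervalIntegral_pos_of_pos_on
      ((hg.mono (Icc_subset_Icc_left hv.1)).intervalIntegrable_of_Icc hv.2.le)
      (fun w hw => hgpos w ⟨hv.1.trans hw.1.le, hw.2.le⟩) hv.2
  have hB : 0 < Bf β 0 t := Real.exp_pos _
  have hp : 0 < pf σ β s t := one_div_pos.2 (mul_pos hB (hC s ⟨le_rfl, hst⟩))
  refine ⟨?_, (integral_exp_neg_mul_gammaMeasure hα hp (by positivity)).symm⟩
  have hint : ∫ v in s..t, σ v ^ 2 / 2 * α * Psi σ β v t l =
      ∫ v in s..t, α * (σ v ^ 2 / 2 * Real.exp (∫ u in (0 : ℝ)..v, β u) * (Bf β 0 t * l) /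
        (1 + Bf β 0 t * l * Cf σ β v t)) := by
    refine intervalIntegral.integral_congr_Ioo_of_le hst.le fun v hv => ?_
    have hCv := hC v (Ioo_subset_Ico_self hv)
    have hBv : Bf β 0 v = (Real.exp (∫ u in (0 : ℝ)..v, β u))⁻¹ := Real.exp_neg _
    have hden : 0 < 1 + Bf β 0 t * l * Cf σ β v t := by positivity
    have hp' : pf σ β v t + l = (1 + Bf β 0 t * l * Cf σ β v t) / (Bf β 0 t * Cf σ β v t) := by
      rw [pf]
      field_simp
    simp only [Psi, hp', gf, hBv]
    field_simp
  have hlog := integral_mul_div_one_add_mul_integral hst.le hg (fun v hv => (hgpos v hv).le)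
    (mul_nonneg hB.le hl)
  have hbase : 1 + l / pf σ β s t = 1 + Bf β 0 t * l * Cf σ β s t := by
    rw [pf, div_div_eq_mul_div]
    ring
  have hbase_pos : 0 < 1 + l / pf σ β s t := by positivity
  rw [hint, intervalIntegral.integral_const_mul]
  change Real.exp (-(α * ∫ v in s..t, σ v ^ 2 / 2 * Real.exp (∫ u in (0 : ℝ)..v, β u) *
    (Bf β 0 t * l) / (1 + Bf β 0 t * l * ∫ w in v..t, σ w ^ 2 / 2 *
      Real.exp (∫ u in (0 : ℝ)..w, β u)))) = _
  rw [hlog, Real.rpow_def_of_pos hbase_pos, hbase, Cf]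
  ring_nf
end

section
/- Let ν be a σ-finite measure on (0,∞) with ∫ (√y ∧ 1) ν(dy) < ∞, and let ã : [0,∞) → ℝ be nonnegative, right-continuous and bounded. Then for every 0 ≤ s < t < ∞ there exists a probability measure Ĩ_{s,t} on [0,∞) whose Laplace transform is ∫_{[0,∞)} e^{−λx} Ĩ_{s,t}(dx) = exp( − ∫_s^t ã(v)·Ψ̃_{v,t}(λ) dv ) for all λ ≥ 0. -/
open MeasureTheory Filter Set

/-- `Ψ̃_{s,t}(λ) = ∫_{(0,∞)} (1 − e^{−y·Ψ_{s,t}(λ)}) ν(dy)` -/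
noncomputable def Psit (σ β : ℝ → ℝ) (ν : Measure ℝ) (s t l : ℝ) : ℝ :=
  ∫ y, (1 - Real.exp (-(y * Psi σ β s t l))) ∂ν

open scoped NNReal ENNReal Topology

/-- The compound Poisson law with finite jump measure `m` on the half-line. -/
theorem exists_compoundPoisson (m : Measure ℝ≥0) [IsFiniteMeasure m] :
    ∃ I : Measure ℝ≥0, IsProbabilityMeasure I ∧ ∀ l : ℝ, 0 ≤ l →
      ∫⁻ x, ENNReal.ofReal (Real.exp (-(l * x))) ∂I =
        ENNReal.ofReal (Real.exp
          ((∫⁻ x, ENNReal.ofReal (Real.exp (-(l * x))) ∂m).toReal - m.real univ)) := by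
  let P : ℕ → Measure ℝ≥0 := fun n => (fun μ => m.conv μ)^[n] (Measure.dirac 0)
  have hP0 : P 0 = Measure.dirac 0 := rfl
  have hPs : ∀ n, P (n + 1) = m.conv (P n) := fun n =>
    Function.iterate_succ_apply' _ _ _
  have hPf : ∀ n, IsFiniteMeasure (P n) := by
    intro n
    induction n with
    | zero => rw [hP0]; infer_instance
    | succ n ih => rw [hPs]; infer_instance
  have hL : ∀ l : ℝ, 0 ≤ l → ∀ n, ∫⁻ x, ENNReal.ofReal (Real.exp (-(l * x))) ∂(P n) =
      (∫⁻ x, ENNReal.ofReal (Real.exp (-(l * x))) ∂m) ^ n := by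
    intro l hl n
    have hmeas : Measurable fun x : ℝ≥0 => ENNReal.ofReal (Real.exp (-(l * x))) := by fun_prop
    induction n with
    | zero => rw [hP0, lintegral_dirac' _ hmeas]; simp
    | succ n ih =>
      rw [hPs, Measure.lintegral_conv hmeas, pow_succ', ← ih, ← lintegral_mul_const _ hmeas]
      refine lintegral_congr fun x => ?_
      rw [← lintegral_const_mul _ hmeas]
      refine lintegral_congr fun y => ?_
      rw [← ENNReal.ofReal_mul (by positivity), ← Real.exp_add]
      congr 2
      push_cast; ring
  let c : ℝ := m.real univ
  let I : Measure ℝ≥0 := Measure.sum fun n =>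
    ENNReal.ofReal (Real.exp (-c) / n.factorial) • P n
  have hI : ∀ l : ℝ, 0 ≤ l →
      ∫⁻ x, ENNReal.ofReal (Real.exp (-(l * x))) ∂I =
        ENNReal.ofReal (Real.exp
          ((∫⁻ x, ENNReal.ofReal (Real.exp (-(l * x))) ∂m).toReal - m.real univ)) := by
    intro l hl
    have hfin : ∫⁻ x, ENNReal.ofReal (Real.exp (-(l * x))) ∂m ≠ ∞ := by
      refine ne_top_of_le_ne_top (measure_ne_top m univ) ?_
      rw [← lintegral_one]
      refine lintegral_mono fun x => ?_
      simp only [ENNReal.ofReal_le_one, Real.exp_le_one_iff, Left.neg_nonpos_iff]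
      positivity
    set q := (∫⁻ x, ENNReal.ofReal (Real.exp (-(l * x))) ∂m).toReal with hq
    have hq0 : 0 ≤ q := ENNReal.toReal_nonneg
    rw [lintegral_sum_measure]
    simp only [lintegral_smul_measure, hL l hl, smul_eq_mul]
    rw [← ENNReal.ofReal_toReal hfin, ← hq]
    have hs : HasSum (fun n : ℕ => Real.exp (-c) / n.factorial * q ^ n)
        (Real.exp (q - c)) := by
      have := (NormedSpace.expSeries_div_hasSum_exp (𝔸 := ℝ) q).mul_left (Real.exp (-c))
      rw [← Real.exp_eq_exp_ℝ, ← Real.exp_add] at this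
      rw [sub_eq_neg_add]
      have h : (fun n : ℕ => Real.exp (-c) / n.factorial * q ^ n) =
          fun n : ℕ => Real.exp (-c) * (q ^ n / n.factorial) := by
        ext n; ring
      rwa [h]
    rw [← hs.tsum_eq, ENNReal.ofReal_tsum_of_nonneg (fun n => by positivity) hs.summable]
    refine tsum_congr fun n => ?_
    rw [ENNReal.ofReal_mul (by positivity), ENNReal.ofReal_pow hq0]
  refine ⟨I, ⟨?_⟩, hI⟩
  have h0 := hI 0 le_rfl
  simpa [Measure.real] using h0

theorem lintegral_exp_neg_gammaMeasure (n : ℕ) {c : ℝ} (hc : 0 ≤ c) :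
    ∫⁻ x, ENNReal.ofReal (Real.exp (-(c * x))) ∂(ProbabilityTheory.gammaMeasure (n + 1) 1) =
      ENNReal.ofReal ((1 / (1 + c)) ^ (n + 1)) := by
  have hm : ∀ r, Measurable (ProbabilityTheory.gammaPDF (n + 1) r) := fun r =>
    (ProbabilityTheory.measurable_gammaPDFReal _ _).ennreal_ofReal
  rw [ProbabilityTheory.gammaMeasure,
    lintegral_withDensity_eq_lintegral_mul _ (hm 1) (by fun_prop)]
  have h1 := ProbabilityTheory.lintegral_gammaPDF_eq_one (a := (n:ℝ) + 1) (r := 1 + c)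
    (by positivity) (by positivity)
  rw [← mul_one (ENNReal.ofReal ((1 / (1 + c)) ^ (n + 1))), ← h1,
    ← lintegral_const_mul _ (hm _)]
  refine lintegral_congr fun x => ?_
  simp only [Pi.mul_apply, ProbabilityTheory.gammaPDF, ProbabilityTheory.gammaPDFReal]
  split_ifs with hx
  · rw [← ENNReal.ofReal_mul' (by positivity), ← ENNReal.ofReal_mul (by positivity)]
    congr 1
    rw [Real.one_rpow]
    have : (1 + c) ^ ((n:ℝ) + 1) = (1 + c) ^ (n + 1) := by
      rw [← Real.rpow_natCast]; push_cast; rfl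
    rw [this, div_pow, one_pow]
    have hg : Real.Gamma ((n:ℝ) + 1) ≠ 0 := (Real.Gamma_pos_of_pos (by positivity)).ne'
    have hc' : (1 + c) ^ (n + 1) ≠ 0 := by positivity
    have he : Real.exp (-((1 + c) * x)) = Real.exp (-(1 * x)) * Real.exp (-(c * x)) := by
      rw [← Real.exp_add]; ring_nf
    rw [he]
    field_simp
  · simp

theorem exists_measure_lintegral_exp_neg_eq {Θ : Type*} [MeasurableSpace Θ] (Λ : Measure Θ)
    {w θ p : Θ → ℝ} (hwm : Measurable w) (hθm : Measurable θ) (hpm : Measurable p)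
    (hw : ∀ᵐ z ∂Λ, 0 ≤ w z) (hθ : ∀ᵐ z ∂Λ, 0 ≤ θ z) (hp : ∀ᵐ z ∂Λ, 0 < p z) :
    ∃ m : Measure ℝ≥0, ∀ l : ℝ, 0 ≤ l →
      ∫⁻ x, ENNReal.ofReal (Real.exp (-(l * x))) ∂m =
        ∫⁻ z, ENNReal.ofReal
          (w z * (Real.exp (-(θ z * (l / (p z + l)))) - Real.exp (-θ z))) ∂Λ := by
  let u : ℕ → Θ → ENNReal := fun n z =>
    ENNReal.ofReal (w z * (Real.exp (-θ z) * θ z ^ (n + 1) / (n + 1).factorial))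
  have hum : ∀ n, Measurable (u n) := fun n => by fun_prop
  let G : ℕ → Measure ℝ := fun n => ProbabilityTheory.gammaMeasure (n + 1) 1
  have hG : ∀ n, IsProbabilityMeasure (G n) := fun n =>
    ProbabilityTheory.isProbabilityMeasure_gammaMeasure (by positivity) one_pos
  have hGpos : ∀ n, ∀ᵐ x ∂(G n), 0 ≤ x := by
    intro n
    have : G n {x | ¬ 0 ≤ x} = 0 := by
      have hms : MeasurableSet {x : ℝ | ¬ 0 ≤ x} := measurableSet_Ici.compl
      rw [show G n = volume.withDensity (ProbabilityTheory.gammaPDF (n + 1) 1) from rfl,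
        withDensity_apply _ hms]
      rw [setLIntegral_congr_fun (g := fun _ => 0) hms
        (fun x hx => ProbabilityTheory.gammaPDF_of_neg (not_le.mp hx))]
      simp
    exact this
  refine ⟨Measure.sum fun n => ((Λ.withDensity (u n)).prod (G n)).map
    (fun z => Real.toNNReal (z.2 / p z.1)), fun l hl => ?_⟩
  have hmeas : Measurable fun x : ℝ≥0 => ENNReal.ofReal (Real.exp (-(l * x))) := by fun_prop
  have hmap : Measurable fun z : Θ × ℝ => Real.toNNReal (z.2 / p z.1) := by fun_prop
  have hterm : ∀ n, ∫⁻ x, ENNReal.ofReal (Real.exp (-(l * x)))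
      ∂(((Λ.withDensity (u n)).prod (G n)).map (fun z => Real.toNNReal (z.2 / p z.1))) =
      ∫⁻ z, u n z * ENNReal.ofReal ((1 / (1 + l / p z)) ^ (n + 1)) ∂Λ := by
    intro n
    have hF : Measurable fun z => ∫⁻ y, ENNReal.ofReal
        (Real.exp (-(l * (Real.toNNReal (y / p z) : ℝ)))) ∂(G n) :=
      Measurable.lintegral_prod_right' (f := fun q : Θ × ℝ => ENNReal.ofReal
        (Real.exp (-(l * (Real.toNNReal (q.2 / p q.1) : ℝ))))) (by fun_prop)
    rw [lintegral_map hmeas hmap, lintegral_prod _ (by fun_prop),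
      lintegral_withDensity_eq_lintegral_mul _ (hum n) hF]
    refine lintegral_congr_ae ?_
    filter_upwards [hp] with z hz
    simp only [Pi.mul_apply]
    congr 1
    rw [← lintegral_exp_neg_gammaMeasure n (c := l / p z) (by positivity)]
    refine lintegral_congr_ae ?_
    filter_upwards [hGpos n] with x hx
    rw [Real.coe_toNNReal _ (by positivity)]
    congr 3
    ring
  rw [lintegral_sum_measure]
  simp only [hterm]
  rw [← lintegral_tsum (fun n => by fun_prop)]
  refine lintegral_congr_ae ?_
  filter_upwards [hw, hθ, hp] with z hwz hθz hpz
  have hs : HasSum (fun n : ℕ => w z * (Real.exp (-θ z) * θ z ^ (n + 1) / (n + 1).factorial) *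
      (1 / (1 + l / p z)) ^ (n + 1))
      (w z * (Real.exp (-(θ z * (l / (p z + l)))) - Real.exp (-θ z))) := by
    have h := NormedSpace.expSeries_div_hasSum_exp (𝔸 := ℝ) (θ z * (1 / (1 + l / p z)))
    rw [← Real.exp_eq_exp_ℝ, ← hasSum_nat_add_iff' 1] at h
    have h2 := (h.mul_left (Real.exp (-θ z))).mul_left (w z)
    have e1 : Real.exp (-(θ z * (l / (p z + l)))) =
        Real.exp (-θ z) * Real.exp (θ z * (1 / (1 + l / p z))) := by
      rw [← Real.exp_add]
      congr 1
      have : p z + l ≠ 0 := by positivity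
      field_simp
      ring
    have e2 : (fun n : ℕ => w z * (Real.exp (-θ z) * θ z ^ (n + 1) / (n + 1).factorial) *
        (1 / (1 + l / p z)) ^ (n + 1)) = fun n : ℕ => w z * (Real.exp (-θ z) *
          ((θ z * (1 / (1 + l / p z))) ^ (n + 1) / (n + 1).factorial)) := by
      ext n
      rw [mul_pow]
      ring
    rw [e1, e2]
    simpa [mul_sub] using h2
  rw [← hs.tsum_eq, ENNReal.ofReal_tsum_of_nonneg (fun n => by positivity) hs.summable]
  refine tsum_congr fun n => ?_
  rw [ENNReal.ofReal_mul (by positivity)]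

theorem exists_probabilityMeasure_integral_exp_neg_eq {Θ : Type*} [MeasurableSpace Θ]
    (Λ : Measure Θ) {w θ p : Θ → ℝ}
    (hwm : Measurable w) (hθm : Measurable θ) (hpm : Measurable p)
    (hw : ∀ᵐ z ∂Λ, 0 ≤ w z) (hθ : ∀ᵐ z ∂Λ, 0 ≤ θ z) (hp : ∀ᵐ z ∂Λ, 0 < p z)
    (hint : Integrable (fun z => w z * (1 - Real.exp (-θ z))) Λ) :
    ∃ I : Measure ℝ, IsProbabilityMeasure I ∧ I (Ici (0 : ℝ))ᶜ = 0 ∧ ∀ l : ℝ, 0 ≤ l →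
      Integrable (fun z => w z * (1 - Real.exp (-(θ z * (l / (p z + l)))))) Λ ∧
      ∫ x, Real.exp (-(l * x)) ∂I =
        Real.exp (-∫ z, w z * (1 - Real.exp (-(θ z * (l / (p z + l))))) ∂Λ) := by
  obtain ⟨m, hm⟩ := exists_measure_lintegral_exp_neg_eq Λ hwm hθm hpm hw hθ hp
  have hle : ∀ l : ℝ, 0 ≤ l → ∀ z, 0 ≤ θ z → 0 < p z →
      θ z * (l / (p z + l)) ≤ θ z := fun l hl z h1 h2 =>
    mul_le_of_le_one_right h1 ((div_le_one (by positivity)).2 (by linarith))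
  have hint2 : ∀ l : ℝ, 0 ≤ l →
      Integrable (fun z => w z * (1 - Real.exp (-(θ z * (l / (p z + l)))))) Λ := by
    intro l hl
    refine hint.mono' (by fun_prop) ?_
    filter_upwards [hw, hθ, hp] with z h1 h2 h3
    have h0 : 0 ≤ θ z * (l / (p z + l)) := by positivity
    rw [Real.norm_of_nonneg]
    · gcongr
      exact hle l hl z h2 h3
    · exact mul_nonneg h1 (by simpa using h0)
  have hsplit : ∀ l : ℝ, ∀ z, w z * (Real.exp (-(θ z * (l / (p z + l)))) - Real.exp (-θ z)) =
      w z * (1 - Real.exp (-θ z)) - w z * (1 - Real.exp (-(θ z * (l / (p z + l))))) :=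
    fun l z => by ring
  have hlap : ∀ l : ℝ, 0 ≤ l → ∫⁻ x, ENNReal.ofReal (Real.exp (-(l * x))) ∂m =
      ENNReal.ofReal (∫ z, w z * (1 - Real.exp (-θ z)) ∂Λ -
        ∫ z, w z * (1 - Real.exp (-(θ z * (l / (p z + l))))) ∂Λ) := by
    intro l hl
    rw [hm l hl, ← integral_sub hint (hint2 l hl), ofReal_integral_eq_lintegral_ofReal
      (f := fun z => _ - _) (hint.sub (hint2 l hl))]
    · simp only [hsplit]
    · filter_upwards [hw, hθ, hp] with z h1 h2 h3
      rw [← hsplit]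
      refine mul_nonneg h1 (sub_nonneg.2 ?_)
      gcongr
      exact hle l hl z h2 h3
  have hmass : m univ = ENNReal.ofReal (∫ z, w z * (1 - Real.exp (-θ z)) ∂Λ) := by
    simpa using hlap 0 le_rfl
  have : IsFiniteMeasure m := ⟨by rw [hmass]; exact ENNReal.ofReal_lt_top⟩
  obtain ⟨I, hI, hIl⟩ := exists_compoundPoisson m
  refine ⟨I.map (fun x : ℝ≥0 => (x : ℝ)), Measure.isProbabilityMeasure_map (by fun_prop), ?_,
    fun l hl => ⟨hint2 l hl, ?_⟩⟩
  · rw [Measure.map_apply (by fun_prop) measurableSet_Ici.compl]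
    convert measure_empty (μ := I)
    ext x
    simp
  · rw [integral_map (by fun_prop) (by fun_prop), integral_eq_lintegral_of_nonneg_ae
      (Eventually.of_forall fun x => by positivity) (by fun_prop), hIl l hl,
      ENNReal.toReal_ofReal (by positivity), hlap l hl, Measure.real, hmass,
      ENNReal.toReal_ofReal, ENNReal.toReal_ofReal]
    · congr 1; ring
    · refine integral_nonneg_of_ae ?_
      filter_upwards [hw, hθ] with z h1 h2
      exact mul_nonneg h1 (by simpa using h2)
    · rw [← integral_sub hint (hint2 l hl)]
      refine integral_nonneg_of_ae ?_
      filter_upwards [hw, hθ, hp] with z h1 h2 h3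
      rw [← hsplit]
      refine mul_nonneg h1 (sub_nonneg.2 ?_)
      gcongr
      exact hle l hl z h2 h3

/-- Right-continuous functions on the half-line are Borel measurable. -/
theorem measurable_comp_max_zero_of_rightContinuous {a : ℝ → ℝ}
    (harc : ∀ x ∈ Ici (0 : ℝ), ContinuousWithinAt a (Ici x) x) :
    Measurable fun x => a (max x 0) := by
  have hseq : ∀ x : ℝ, Tendsto (fun n : ℕ => ((⌊(n + 1 : ℝ) * x⌋ : ℝ) + 1) / (n + 1)) atTop
      (𝓝[≥] x) := by
    intro x
    refine tendsto_nhdsWithin_iff.2 ⟨?_, Eventually.of_forall fun n => ?_⟩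
    · have h1 : Tendsto (fun n : ℕ => x + 1 / ((n : ℝ) + 1)) atTop (𝓝 (x + 0)) :=
        tendsto_one_div_add_atTop_nhds_zero_nat.const_add x
      rw [add_zero] at h1
      refine tendsto_of_tendsto_of_tendsto_of_le_of_le tendsto_const_nhds h1 (fun n => ?_)
        fun n => ?_
      · have hn : (0 : ℝ) < n + 1 := by positivity
        rw [le_div_iff₀ hn]
        linarith [Int.lt_floor_add_one ((n + 1 : ℝ) * x)]
      · have hn : (0 : ℝ) < n + 1 := by positivity
        simp only
        have h2 : (x + 1 / ((n : ℝ) + 1)) * (n + 1) = (n + 1) * x + 1 := by field_simp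
        rw [div_le_iff₀ hn, h2]
        linarith [Int.floor_le ((n + 1 : ℝ) * x)]
    · have hn : (0 : ℝ) < n + 1 := by positivity
      simp only [mem_Ici]
      rw [le_div_iff₀ hn]
      linarith [Int.lt_floor_add_one ((n + 1 : ℝ) * x)]
  refine measurable_of_tendsto_metrizable
    (f := fun (n : ℕ) x => a (max (((⌊(n + 1 : ℝ) * x⌋ : ℝ) + 1) / (n + 1)) 0)) (fun n => ?_) ?_
  · exact (measurable_from_top (f := fun k : ℤ => a (max (((k : ℝ) + 1) / (n + 1)) 0))).comp
      (Int.measurable_floor.comp (measurable_const_mul _))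
  · refine tendsto_pi_nhds.2 fun x => ?_
    have h := harc (max x 0) (mem_Ici.2 (le_max_right _ _))
    refine h.tendsto.comp (tendsto_nhdsWithin_iff.2 ⟨?_, ?_⟩)
    · exact ((continuous_id.max continuous_const).tendsto x).comp
        ((hseq x).mono_right nhdsWithin_le_nhds)
    · filter_upwards [(tendsto_nhdsWithin_iff.1 (hseq x)).2] with n hn
      exact max_le_max_right 0 (mem_Ici.1 hn)

theorem one_sub_exp_neg_mul_le {y k : ℝ} (hy : 0 ≤ y) (hk : 0 ≤ k) :
    1 - Real.exp (-(y * k)) ≤ (√k + 1) * min (√y) 1 := by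
  have h1 : 1 - Real.exp (-(y * k)) ≤ 1 := by linarith [Real.exp_pos (-(y * k))]
  have h2 : 1 - Real.exp (-(y * k)) ≤ y * k := by linarith [Real.add_one_le_exp (-(y * k))]
  have h3 : 1 - Real.exp (-(y * k)) ≤ √y * √k := by
    rw [← Real.sqrt_mul hy]
    rcases le_total 1 (√(y * k)) with h | h
    · exact h1.trans h
    · have h4 := Real.mul_self_sqrt (mul_nonneg hy hk)
      nlinarith [Real.sqrt_nonneg (y * k)]
  have hk' := Real.sqrt_nonneg k
  have hy' := Real.sqrt_nonneg y
  rcases le_total (√y) 1 with h | h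
  · rw [min_eq_left h]
    linarith
  · rw [min_eq_right h]
    linarith

theorem integrable_sqrt_div_sub (K : ℝ) (s t : ℝ) (hst : s ≤ t) :
    Integrable (fun v => √(K / (t - v))) (volume.restrict (Ioo s t)) := by
  have h1 : IntervalIntegrable (fun x : ℝ => √K * x ^ (-(1 / 2) : ℝ)) volume (t - s) (t - t) :=
    (intervalIntegral.intervalIntegrable_rpow' (by norm_num)).const_mul _
  have h2 := h1.comp_sub_left t
  simp only [sub_sub_cancel] at h2
  rw [intervalIntegrable_iff_integrableOn_Ioo_of_le hst] at h2
  refine h2.congr ?_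
  filter_upwards [ae_restrict_mem measurableSet_Ioo] with v hv
  have hv' : 0 ≤ t - v := sub_nonneg.2 hv.2.le
  rw [Real.sqrt_div' _ hv', Real.rpow_neg hv', ← Real.sqrt_eq_rpow, div_eq_mul_inv]

/-- The statement of `stmt_18` for coefficients that are continuous on the whole line. -/
theorem exists_probabilityMeasure_of_continuous (σ β : ℝ → ℝ)
    (hσ : Continuous σ) (hβ : Continuous β) (hσpos : ∀ x, 0 < σ x) (hβnn : ∀ x, 0 ≤ β x)
    (ν : Measure ℝ) [SigmaFinite ν] (hνsupp : ν {y : ℝ | ¬ 0 < y} = 0)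
    (hνint : (∫⁻ y, ENNReal.ofReal (min (Real.sqrt y) 1) ∂ν) < ⊤)
    (a : ℝ → ℝ) (ham : Measurable a) (hann : ∀ x, 0 ≤ a x) (M : ℝ) (habd : ∀ x, a x ≤ M)
    (s t : ℝ) (hst : s < t) :
    ∃ I : Measure ℝ, IsProbabilityMeasure I ∧ I (Set.Ici (0:ℝ))ᶜ = 0 ∧
      ∀ l : ℝ, 0 ≤ l →
        (∫ x, Real.exp (-(l * x)) ∂I) =
          Real.exp (-∫ v in s..t, a v * Psit σ β ν v t l) := by
  have hβi : ∀ u v, IntervalIntegrable β volume u v := fun u v => hβ.intervalIntegrable u v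
  have hBcont : Continuous fun v => ∫ u in (0:ℝ)..v, β u :=
    intervalIntegral.continuous_primitive hβi 0
  let f : ℝ → ℝ := fun v => σ v ^ 2 / 2 * Real.exp (∫ u in (0:ℝ)..v, β u)
  have hf : Continuous f := by fun_prop
  have hfpos : ∀ v, 0 < f v := fun v => by have := hσpos v; positivity
  obtain ⟨v₀, -, hv₀⟩ := isCompact_Icc.exists_isMinOn (nonempty_Icc.2 hst.le) hf.continuousOn
  have hc := hfpos v₀
  have hCcont : Continuous fun v => Cf σ β v t := by
    have h : (fun v => Cf σ β v t) = fun v => -∫ u in t..v, f u :=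
      funext fun v => intervalIntegral.integral_symm _ _
    rw [h]
    exact (intervalIntegral.continuous_primitive (fun u v => hf.intervalIntegrable u v) t).neg
  have hBfcont : Continuous fun v => Bf β 0 v := Real.continuous_exp.comp hBcont.neg
  have hgm : Measurable fun v => gf σ β v t :=
    (hBfcont.mul hCcont).measurable.const_div 1
  have hpm : Measurable fun v => pf σ β v t :=
    (continuous_const.mul hCcont).measurable.const_div 1
  have hB : ∀ u v, 0 < Bf β u v := fun u v => Real.exp_pos _
  have hCle : ∀ v ∈ Ioo s t, f v₀ * (t - v) ≤ Cf σ β v t := by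
    intro v hv
    have h1 : ∫ _ in v..t, f v₀ = f v₀ * (t - v) := by
      rw [intervalIntegral.integral_const, smul_eq_mul, mul_comm]
    rw [← h1]
    exact intervalIntegral.integral_mono_on hv.2.le intervalIntegrable_const
      (hf.intervalIntegrable _ _) fun x hx => hv₀ ⟨hv.1.le.trans hx.1, hx.2⟩
  have hCpos : ∀ v ∈ Ioo s t, 0 < Cf σ β v t := fun v hv =>
    (mul_pos hc (sub_pos.2 hv.2)).trans_le (hCle v hv)
  have hBle : ∀ v ∈ Ioo s t, Bf β 0 t ≤ Bf β 0 v := by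
    intro v hv
    refine Real.exp_le_exp.2 (neg_le_neg ?_)
    have h1 := intervalIntegral.integral_add_adjacent_intervals (hβi 0 v) (hβi v t)
    have h2 : 0 ≤ ∫ u in v..t, β u := intervalIntegral.integral_nonneg hv.2.le fun u _ => hβnn u
    linarith
  have hgpos : ∀ v ∈ Ioo s t, 0 < gf σ β v t := fun v hv =>
    one_div_pos.2 (mul_pos (hB _ _) (hCpos v hv))
  have hppos : ∀ v ∈ Ioo s t, 0 < pf σ β v t := fun v hv =>
    one_div_pos.2 (mul_pos (hB _ _) (hCpos v hv))
  have hgle : ∀ v ∈ Ioo s t, gf σ β v t ≤ 1 / (Bf β 0 t * f v₀) / (t - v) := by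
    intro v hv
    have hv' := sub_pos.2 hv.2
    have hBt := hB 0 t
    rw [gf, div_div, mul_assoc]
    gcongr
    · exact (hB 0 v).le
    · exact hBle v hv
    · exact hCle v hv
  have hM : 0 ≤ M := (hann 0).trans (habd 0)
  let Λ : Measure (ℝ × ℝ) := (volume.restrict (Ioo s t)).prod ν
  have hv : ∀ᵐ z ∂Λ, z.1 ∈ Ioo s t :=
    Measure.quasiMeasurePreserving_fst.ae (ae_restrict_mem measurableSet_Ioo)
  have hy : ∀ᵐ z ∂Λ, 0 < z.2 := Measure.quasiMeasurePreserving_snd.ae hνsupp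
  have hνi : Integrable (fun y => min (√y) 1) ν := by
    refine ⟨by fun_prop, ?_⟩
    rwa [hasFiniteIntegral_iff_ofReal (Eventually.of_forall fun y => by positivity)]
  have hint : Integrable (fun z : ℝ × ℝ => a z.1 * (1 - Real.exp (-(z.2 * gf σ β z.1 t)))) Λ := by
    have hk := ((integrable_sqrt_div_sub (1 / (Bf β 0 t * f v₀)) s t hst.le).add
      (integrable_const (1 : ℝ))).const_mul M
    refine (hk.mul_prod hνi).mono' (by fun_prop) ?_
    filter_upwards [hv, hy] with z hz hz2
    have hg := hgpos z.1 hz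
    rw [Real.norm_of_nonneg (mul_nonneg (hann _) (by simp; positivity))]
    simp only [Pi.add_apply]
    rw [mul_assoc]
    refine mul_le_mul (habd _) ((one_sub_exp_neg_mul_le hz2.le hg.le).trans ?_)
      (by simp; positivity) hM
    gcongr
    exact hgle z.1 hz
  obtain ⟨I, hI, hI0, hIl⟩ := exists_probabilityMeasure_integral_exp_neg_eq Λ
    (w := fun z => a z.1) (θ := fun z => z.2 * gf σ β z.1 t) (p := fun z => pf σ β z.1 t)
    (by fun_prop) (by fun_prop) (by fun_prop) (Eventually.of_forall fun z => hann _)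
    (by filter_upwards [hv, hy] with z hz hz2 using mul_nonneg hz2.le (hgpos _ hz).le)
    (by filter_upwards [hv] with z hz using hppos _ hz) hint
  refine ⟨I, hI, hI0, fun l hl => ?_⟩
  obtain ⟨hi, he⟩ := hIl l hl
  rw [he, integral_prod _ hi, intervalIntegral.integral_of_le hst.le,
    integral_Ioc_eq_integral_Ioo]
  simp only [integral_const_mul, Psit, Psi, mul_assoc, mul_div_assoc]

/-- For `ν` σ-finite on `(0,∞)` with `∫ (√y∧1) ν(dy) < ∞` and `ã` nonnegative,
right-continuous and bounded, there is for each `0 ≤ s < t` a probability measure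
`Ĩ_{s,t}` on `[0,∞)` with Laplace transform `λ ↦ exp(−∫_s^t ã(v)·Ψ̃_{v,t}(λ) dv)`. -/
theorem stmt_18 (σ β : ℝ → ℝ)
    (hσc : ContinuousOn σ (Set.Ici 0)) (hβc : ContinuousOn β (Set.Ici 0))
    (hσpos : ∀ x ∈ Set.Ici (0:ℝ), 0 < σ x) (hβnn : ∀ x ∈ Set.Ici (0:ℝ), 0 ≤ β x)
    (ν : Measure ℝ) (hσfin : SigmaFinite ν) (hνsupp : ν {y : ℝ | ¬ 0 < y} = 0)
    (hνint : (∫⁻ y, ENNReal.ofReal (min (Real.sqrt y) 1) ∂ν) < ⊤)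
    (a : ℝ → ℝ) (hann : ∀ x ∈ Set.Ici (0:ℝ), 0 ≤ a x)
    (harc : ∀ x ∈ Set.Ici (0:ℝ), ContinuousWithinAt a (Set.Ici x) x)
    (M : ℝ) (habd : ∀ x ∈ Set.Ici (0:ℝ), a x ≤ M)
    (s t : ℝ) (hs : 0 ≤ s) (hst : s < t) :
    ∃ I : Measure ℝ, IsProbabilityMeasure I ∧ I (Set.Ici (0:ℝ))ᶜ = 0 ∧
      ∀ l : ℝ, 0 ≤ l →
        (∫ x, Real.exp (-(l * x)) ∂I) =
          Real.exp (-∫ v in s..t, a v * Psit σ β ν v t l) := by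
  have hmax : ∀ x : ℝ, max x 0 ∈ Ici (0 : ℝ) := fun x => mem_Ici.2 (le_max_right _ _)
  have hcm : Continuous fun x : ℝ => max x 0 := by fun_prop
  obtain ⟨I, hI, hI0, hIl⟩ := exists_probabilityMeasure_of_continuous
    (fun x => σ (max x 0)) (fun x => β (max x 0))
    (hσc.comp_continuous hcm hmax) (hβc.comp_continuous hcm hmax)
    (fun x => hσpos _ (hmax x)) (fun x => hβnn _ (hmax x)) ν hνsupp hνint
    (fun x => a (max x 0)) (measurable_comp_max_zero_of_rightContinuous harc)
    (fun x => hann _ (hmax x)) M (fun x => habd _ (hmax x)) s t hst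
  refine ⟨I, hI, hI0, fun l hl => ?_⟩
  have hβ0 : ∀ v, 0 ≤ v → ∫ u in (0:ℝ)..v, β (max u 0) = ∫ u in (0:ℝ)..v, β u := by
    intro v hv
    refine intervalIntegral.integral_congr fun u hu => ?_
    rw [uIcc_of_le hv] at hu
    simp only [max_eq_left hu.1]
  have hB : ∀ v, 0 ≤ v → Bf (fun x => β (max x 0)) 0 v = Bf β 0 v := fun v hv => by
    simp only [Bf, hβ0 v hv]
  have hC : ∀ v, 0 ≤ v → v ≤ t →
      Cf (fun x => σ (max x 0)) (fun x => β (max x 0)) v t = Cf σ β v t := by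
    intro v hv hvt
    refine intervalIntegral.integral_congr fun u hu => ?_
    rw [uIcc_of_le hvt] at hu
    have hu0 := hv.trans hu.1
    simp only [max_eq_left hu0, hβ0 u hu0]
  rw [hIl l hl]
  congr 2
  refine intervalIntegral.integral_congr fun v hv => ?_
  rw [uIcc_of_le hst.le] at hv
  have hv0 := hs.trans hv.1
  simp only [Psit, Psi, gf, pf, hB v hv0, hB t (hv0.trans hv.2), hC v hv0 hv.2, max_eq_left hv0]
end
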